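/- For every q ≥ 1 there exists a constant C(q) > 0, depending only on q, N, R₀, R₁, such that (∫_A |u|^q dx)^{1/q} ≤ C(q) (∫_A (|∇u|² + u²) dx)^{1/2} for every u ∈ K. -/

import Mathlib

open MeasureTheory Real Set

noncomputable section

/-- The open annulus `{x : R₀ < |x| < R₁}` in `ℝ^N`. -/
def annulus (N : ℕ) (R₀ R₁ : ℝ) : Set (EuclideanSpace ℝ (Fin N)) :=
  {x | R₀ < ‖x‖ ∧ ‖x‖ < R₁}

/-- The last coordinate `x_N` of a point of `ℝ^N`. -/
def lastCoord {N : ℕ} (x : EuclideanSpace ℝ (Fin N)) : ℝ :=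
  if h : 0 < N then x ⟨N - 1, by omega⟩ else 0

/-- The polar angle `θ = arcsin (x_N / |x|)`. -/
def angleOf {N : ℕ} (x : EuclideanSpace ℝ (Fin N)) : ℝ :=
  Real.arcsin (lastCoord x / ‖x‖)

/-- `u` is axially symmetric on the closed annulus with representative `𝔲 = 𝔲(r,θ)`. -/
def IsAxiallySymmRep (N : ℕ) (R₀ R₁ : ℝ) (u : EuclideanSpace ℝ (Fin N) → ℝ)
    (𝔲 : ℝ → ℝ → ℝ) : Prop :=
  ∀ x ∈ closure (annulus N R₀ R₁), u x = 𝔲 ‖x‖ (angleOf x)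

/-- Membership in the cone `K̂`: `C¹` on the closed annulus, nonnegative, axially symmetric,
even in `θ` and nonincreasing in `θ` on `[0, π/2]`. -/
def memKhat (N : ℕ) (R₀ R₁ : ℝ) (u : EuclideanSpace ℝ (Fin N) → ℝ) : Prop :=
  ContDiffOn ℝ 1 u (closure (annulus N R₀ R₁)) ∧
  (∀ x ∈ closure (annulus N R₀ R₁), 0 ≤ u x) ∧
  ∃ 𝔲 : ℝ → ℝ → ℝ,
    IsAxiallySymmRep N R₀ R₁ u 𝔲 ∧
    (∀ r ∈ Icc R₀ R₁, ∀ θ ∈ Icc (-(π / 2)) (π / 2), 𝔲 r (-θ) = 𝔲 r θ) ∧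
    (∀ r ∈ Icc R₀ R₁, AntitoneOn (𝔲 r) (Icc 0 (π / 2)))

/-- `C¹₀(A)` : `C¹` on the closed annulus, vanishing on the boundary. -/
def memC10 (N : ℕ) (R₀ R₁ : ℝ) (u : EuclideanSpace ℝ (Fin N) → ℝ) : Prop :=
  ContDiffOn ℝ 1 u (closure (annulus N R₀ R₁)) ∧
  ∀ x : EuclideanSpace ℝ (Fin N), (‖x‖ = R₀ ∨ ‖x‖ = R₁) → u x = 0

/-- The cone `K = K̂ ∩ C¹₀(A)`. -/
def memK (N : ℕ) (R₀ R₁ : ℝ) (u : EuclideanSpace ℝ (Fin N) → ℝ) : Prop :=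
  memKhat N R₀ R₁ u ∧ ∀ x : EuclideanSpace ℝ (Fin N), (‖x‖ = R₀ ∨ ‖x‖ = R₁) → u x = 0

/-- The squared `H¹(A)`-norm `∫_A (|∇u|² + u²) dx`. -/
def H1sq (N : ℕ) (R₀ R₁ : ℝ) (u : EuclideanSpace ℝ (Fin N) → ℝ) : ℝ :=
  ∫ x in annulus N R₀ R₁,
    (‖fderivWithin ℝ u (closure (annulus N R₀ R₁)) x‖ ^ 2 + (u x) ^ 2)

/-- The energy functional `I(u) = ½‖u‖²_{H¹} − (1/p) ∫_A a |u|^p`. -/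
def funcI (N : ℕ) (R₀ R₁ : ℝ) (a : EuclideanSpace ℝ (Fin N) → ℝ) (p : ℝ)
    (u : EuclideanSpace ℝ (Fin N) → ℝ) : ℝ :=
  (1 / 2) * H1sq N R₀ R₁ u - (1 / p) * ∫ x in annulus N R₀ R₁, a x * |u x| ^ p

/-- The Nehari set `N_K`. -/
def memNehari (N : ℕ) (R₀ R₁ : ℝ) (a : EuclideanSpace ℝ (Fin N) → ℝ) (p : ℝ)
    (u : EuclideanSpace ℝ (Fin N) → ℝ) : Prop :=
  memK N R₀ R₁ u ∧ (∃ x ∈ annulus N R₀ R₁, u x ≠ 0) ∧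
  H1sq N R₀ R₁ u = ∫ x in annulus N R₀ R₁, a x * |u x| ^ p

/-- The Nehari level `c_I = inf_{N_K} I`. -/
def cI (N : ℕ) (R₀ R₁ : ℝ) (a : EuclideanSpace ℝ (Fin N) → ℝ) (p : ℝ) : ℝ :=
  sInf {c | ∃ u, memNehari N R₀ R₁ a p u ∧ c = funcI N R₀ R₁ a p u}

/-- Test functions `C_c^∞(A)`. -/
def IsTestFun (N : ℕ) (R₀ R₁ : ℝ) (φ : EuclideanSpace ℝ (Fin N) → ℝ) : Prop :=
  ContDiff ℝ (⊤ : ℕ∞) φ ∧ HasCompactSupport φ ∧ tsupport φ ⊆ annulus N R₀ R₁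

/-- Weak solution of `−Δu + u = a(x)|u|^{p−2}u` in `A`, `u = 0` on `∂A`. -/
def IsWeakSolution (N : ℕ) (R₀ R₁ : ℝ) (a : EuclideanSpace ℝ (Fin N) → ℝ) (p : ℝ)
    (u : EuclideanSpace ℝ (Fin N) → ℝ) : Prop :=
  memC10 N R₀ R₁ u ∧
  ∀ φ : EuclideanSpace ℝ (Fin N) → ℝ, IsTestFun N R₀ R₁ φ →
    (∫ x in annulus N R₀ R₁,
      (fderivWithin ℝ u (closure (annulus N R₀ R₁)) x (gradient φ x) + u x * φ x))
    = ∫ x in annulus N R₀ R₁, a x * |u x| ^ (p - 2) * u x * φ x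

/-- The (classical) Laplacian, as the sum of second partial derivatives. -/
def lapl {N : ℕ} (u : EuclideanSpace ℝ (Fin N) → ℝ) (x : EuclideanSpace ℝ (Fin N)) : ℝ :=
  ∑ i : Fin N,
    fderiv ℝ (fun y => fderiv ℝ u y (EuclideanSpace.single i 1)) x (EuclideanSpace.single i 1)

/-- The inclusion `ℝ^{N-1} → ℝ^N`, `x' ↦ (x',0)`. -/
def embedHyper (N : ℕ) (x' : EuclideanSpace ℝ (Fin (N - 1))) : EuclideanSpace ℝ (Fin N) :=
  (WithLp.equiv 2 (Fin N → ℝ)).symm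
    (fun j => if h : (j : ℕ) < N - 1 then x' ⟨j, h⟩ else 0)

/-- A `C¹` distance on the closed annulus. -/
def C1dist (N : ℕ) (R₀ R₁ : ℝ) (u v : EuclideanSpace ℝ (Fin N) → ℝ) : ℝ :=
  (⨆ x : closure (annulus N R₀ R₁), |u x - v x|) +
  (⨆ x : closure (annulus N R₀ R₁),
    ‖fderivWithin ℝ u (closure (annulus N R₀ R₁)) x
      - fderivWithin ℝ v (closure (annulus N R₀ R₁)) x‖)

end

/-- transverse part -/
noncomputable def s5rho {n : ℕ} (x : EuclideanSpace ℝ (Fin (n+1))) : ℝ :=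
  ‖(WithLp.toLp 2 (fun i : Fin n => x i.castSucc) : EuclideanSpace ℝ (Fin n))‖

lemma s5_polar {F : Type*} [NormedAddCommGroup F] [NormedSpace ℝ F] [Nontrivial F]
    [MeasurableSpace F] [BorelSpace F] [FiniteDimensional ℝ F] (μ : Measure F)
    [μ.IsAddHaarMeasure] (f : ℝ → ENNReal) (hf : Measurable f) :
    ∫⁻ x, f ‖x‖ ∂μ = μ.toSphere univ *
      ∫⁻ y in Ioi (0:ℝ), ENNReal.ofReal (y ^ (Module.finrank ℝ F - 1)) * f y := by
  calc
    ∫⁻ x, f (‖x‖) ∂μ = ∫⁻ x : ({(0)}ᶜ : Set F), f (‖x.1‖) ∂(μ.comap (↑)) := by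
      rw [lintegral_subtype_comap (measurableSet_singleton _).compl fun x ↦ f (‖x‖),
        restrict_compl_singleton]
    _ = ∫⁻ x, f x.2 ∂μ.toSphere.prod (.volumeIoiPow (Module.finrank ℝ F - 1)) := by
      simpa using μ.measurePreserving_homeomorphUnitSphereProd.lintegral_comp_emb
        (Homeomorph.measurableEmbedding _) (f ∘ Subtype.val ∘ Prod.snd)
    _ = μ.toSphere univ * ∫⁻ x : Ioi (0 : ℝ), f x ∂.volumeIoiPow (Module.finrank ℝ F - 1) := by
      rw [lintegral_prod _ (by fun_prop)]
      simp [mul_comm]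
    _ = _ := by
      congr 1
      rw [Measure.volumeIoiPow, lintegral_withDensity_eq_lintegral_mul _ (by fun_prop) (by fun_prop)]
      exact lintegral_subtype_comap measurableSet_Ioi
        (fun a : ℝ => ENNReal.ofReal (a ^ (Module.finrank ℝ F - 1)) * f a)

lemma s5_push (n : ℕ) (hn : 2 ≤ n) : ∃ c : ENNReal, c ≠ 0 ∧ c ≠ ⊤ ∧
    ∀ G : ℝ × ℝ → ENNReal, Measurable G →
      ∫⁻ x : EuclideanSpace ℝ (Fin (n+1)), G (s5rho x, x (Fin.last n))
        = c * ∫⁻ z : ℝ, ∫⁻ r in Ioi (0:ℝ), ENNReal.ofReal (r ^ (n-1)) * G (r, z) := by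
  have : Nontrivial (EuclideanSpace ℝ (Fin n)) := by
    have : Nonempty (Fin n) := ⟨⟨0, by omega⟩⟩
    infer_instance
  refine ⟨(volume : Measure (EuclideanSpace ℝ (Fin n))).toSphere univ, ?_, ?_, ?_⟩
  · rw [ne_eq, Measure.measure_univ_eq_zero]
    exact Measure.toSphere_ne_zero _
  · exact measure_ne_top _ _
  · intro G hG
    have h1 := (PiLp.volume_preserving_toLp (Fin (n+1))).lintegral_comp_emb
      (MeasurableEquiv.toLp 2 (Fin (n+1) → ℝ)).measurableEmbedding
      (fun x : EuclideanSpace ℝ (Fin (n+1)) => G (s5rho x, x (Fin.last n)))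
    have h2 := (volume_preserving_piFinSuccAbove (fun _ : Fin (n+1) => ℝ) (Fin.last n)).lintegral_comp_emb
      (MeasurableEquiv.measurableEmbedding _)
      (fun p => G (‖(WithLp.toLp 2 p.2 : EuclideanSpace ℝ (Fin n))‖, p.1))
    rw [← h1]
    have h3 : ∀ a : Fin (n+1) → ℝ, 
      G (s5rho (WithLp.toLp 2 a : EuclideanSpace ℝ (Fin (n+1))), (WithLp.toLp 2 a : EuclideanSpace ℝ (Fin (n+1))) (Fin.last n)) = 
      (fun p => G (‖(WithLp.toLp 2 p.2 : EuclideanSpace ℝ (Fin n))‖, p.1)) ((MeasurableEquiv.piFinSuccAbove (fun _ : Fin (n+1) => ℝ) (Fin.last n)) a) := by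
      intro a
      simp [s5rho, MeasurableEquiv.piFinSuccAbove, Fin.insertNthEquiv]
      rfl
      
    simp_rw [h3]
    rw [h2, Measure.volume_eq_prod, lintegral_prod _ (by fun_prop)]
    rw [← lintegral_const_mul']
    swap
    · exact measure_ne_top _ _
    congr 1 with z
    have h4 := (PiLp.volume_preserving_toLp (Fin n)).lintegral_comp_emb
      (MeasurableEquiv.toLp 2 (Fin n → ℝ)).measurableEmbedding
      (fun x : EuclideanSpace ℝ (Fin n) => G (‖x‖, z))
    rw [h4, s5_polar volume (fun r => G (r,z)) (by fun_prop)]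
    simp

lemma s5_gns (q : ℝ) (hq : 1 ≤ q) (s : Set (ℝ × ℝ)) (hs : IsCompact s) :
    ∃ C : ENNReal, C ≠ ⊤ ∧ ∀ v : ℝ × ℝ → ℝ, ContDiff ℝ 1 v → Function.support v ⊆ s →
      (∫⁻ p, ENNReal.ofReal (|v p| ^ q)) ^ (1 / q) ≤
        C * (∫⁻ p, ENNReal.ofReal (‖fderiv ℝ v p‖ ^ 2)) ^ (1 / 2 : ℝ) := by
  have hq0 : 0 < q := by linarith
  let q' : NNReal := ⟨q, by linarith⟩
  let p' : NNReal := ⟨2 * q / (q + 1), by positivity⟩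
  have hp'2 : (p' : ENNReal) ≤ 2 := by
    have : p' ≤ 2 := by
      rw [← NNReal.coe_le_coe]
      change 2 * q / (q + 1) ≤ 2
      rw [div_le_iff₀ (by positivity)]; linarith
    exact_mod_cast this
  refine ⟨eLpNormLESNormFDerivOfLeConst ℝ (volume : Measure (ℝ × ℝ)) s p' q' *
    (volume s) ^ (1 / (p' : ENNReal).toReal - 1 / (2 : ENNReal).toReal), ?_, ?_⟩
  · refine ENNReal.mul_ne_top ENNReal.coe_ne_top (ENNReal.rpow_ne_top_of_nonneg ?_ hs.measure_ne_top)
    rw [sub_nonneg]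
    change 1 / 2 ≤ 1 / (2 * q / (q + 1))
    rw [div_le_div_iff₀ (by positivity) (by positivity)]
    have : 2 * q / (q+1) ≤ 2 := by rw [div_le_iff₀ (by positivity)]; linarith
    linarith
  · intro v hv hvs
    have h := eLpNorm_le_eLpNorm_fderiv_of_le (volume : Measure (ℝ × ℝ)) hv hvs (p := p') (q := q')
      (by
        rw [← NNReal.coe_le_coe]
        change 1 ≤ 2 * q / (q + 1)
        rw [le_div_iff₀ (by positivity)]; linarith)
      (by
        rw [← NNReal.coe_lt_coe]
        simp only [Module.finrank_prod, Module.finrank_self]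
        push_cast
        change 2 * q / (q + 1) < 2
        rw [div_lt_iff₀ (by positivity)]; linarith)
      (by
        simp only [Module.finrank_prod, Module.finrank_self]
        push_cast
        change (2 * q / (q + 1))⁻¹ - 2⁻¹ ≤ q⁻¹
        rw [inv_div, inv_eq_one_div q, inv_eq_one_div (2:ℝ)]
        have : (q + 1) / (2 * q) - 1 / 2 = 1 / (2 * q) := by field_simp; ring
        rw [this]
        exact one_div_le_one_div_of_le (by positivity) (by linarith))
      hs.isBounded
    have hfs : Function.support (fderiv ℝ v) ⊆ s :=
      (support_fderiv_subset ℝ).trans (closure_minimal hvs hs.isClosed)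
    have h2 := eLpNorm_le_eLpNorm_mul_rpow_measure_univ (μ := volume.restrict s) hp'2
      ((hv.continuous_fderiv (by norm_num)).aestronglyMeasurable)
    have r1 : ∀ p : ENNReal, eLpNorm (fderiv ℝ v) p (volume.restrict s) =
        eLpNorm (fderiv ℝ v) p volume :=
      fun p => eLpNorm_restrict_eq_of_support_subset (f := fderiv ℝ v) hfs
    rw [r1, r1, Measure.restrict_apply_univ] at h2
    rw [eLpNorm_eq_lintegral_rpow_enorm_toReal (by
      have : q' ≠ 0 := fun h0 => hq0.ne' (congrArg NNReal.toReal h0)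
      exact_mod_cast this) (by simp)] at h
    rw [eLpNorm_eq_lintegral_rpow_enorm_toReal (p := 2) (by simp) (by simp)] at h2
    have e1 : ∀ p, ENNReal.ofReal (|v p| ^ q) = ‖v p‖ₑ ^ (q' : ENNReal).toReal := by
      intro p
      rw [← ENNReal.ofReal_rpow_of_nonneg (abs_nonneg _) hq0.le, ← Real.enorm_eq_ofReal_abs]
      rfl
    have e2 : ∀ p, ENNReal.ofReal (‖fderiv ℝ v p‖ ^ 2) = ‖fderiv ℝ v p‖ₑ ^ (2 : ENNReal).toReal := by
      intro p
      rw [ENNReal.ofReal_pow (norm_nonneg _), ofReal_norm]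
      simp
    simp_rw [e1, e2]
    refine h.trans ?_
    rw [mul_assoc]
    gcongr
    rw [mul_comm]
    exact h2

lemma s5_norm_sq {n : ℕ} (x : EuclideanSpace ℝ (Fin (n+1))) :
    ‖x‖ ^ 2 = s5rho x ^ 2 + x (Fin.last n) ^ 2 := by
  rw [s5rho, EuclideanSpace.norm_sq_eq, EuclideanSpace.norm_sq_eq, Fin.sum_univ_castSucc]
  simp

lemma s5rho_nonneg {n : ℕ} (x : EuclideanSpace ℝ (Fin (n+1))) : 0 ≤ s5rho x := norm_nonneg _

lemma s5rho_continuous {n : ℕ} : Continuous (s5rho (n := n)) := by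
  unfold s5rho
  fun_prop

/-- The plane spanned by `e` and the axis. -/
noncomputable def s5L {n : ℕ} (e : EuclideanSpace ℝ (Fin (n+1))) :
    ℝ × ℝ →L[ℝ] EuclideanSpace ℝ (Fin (n+1)) :=
  (ContinuousLinearMap.fst ℝ ℝ ℝ).smulRight e +
    (ContinuousLinearMap.snd ℝ ℝ ℝ).smulRight (EuclideanSpace.single (Fin.last n) (1:ℝ))

lemma s5L_apply {n : ℕ} (e : EuclideanSpace ℝ (Fin (n+1))) (p : ℝ × ℝ) :
    s5L e p = p.1 • e + p.2 • EuclideanSpace.single (Fin.last n) (1:ℝ) := by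
  simp [s5L]

lemma s5L_norm {n : ℕ} (e : EuclideanSpace ℝ (Fin (n+1))) (he : ‖e‖ = 1) : ‖s5L e‖ ≤ 2 := by
  refine ContinuousLinearMap.opNorm_le_bound _ (by norm_num) fun p => ?_
  rw [s5L_apply]
  refine (norm_add_le _ _).trans ?_
  rw [norm_smul, norm_smul, he]
  have h1 := norm_fst_le p
  have h2 := norm_snd_le p
  simp only [PiLp.norm_single, norm_one, mul_one]
  linarith

lemma s5L_last {n : ℕ} (e : EuclideanSpace ℝ (Fin (n+1))) (he : e (Fin.last n) = 0) (p : ℝ × ℝ) :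
    s5L e p (Fin.last n) = p.2 := by
  rw [s5L_apply]; simp [he]

lemma s5L_norm_sq {n : ℕ} (e : EuclideanSpace ℝ (Fin (n+1))) (he1 : ‖e‖ = 1)
    (he : e (Fin.last n) = 0) (p : ℝ × ℝ) :
    ‖s5L e p‖ ^ 2 = p.1 ^ 2 + p.2 ^ 2 := by
  rw [s5L_apply, norm_add_sq_real, norm_smul, norm_smul, inner_smul_left, inner_smul_right, he1,
    EuclideanSpace.inner_single_right]
  simp [he]

lemma s5_exists_e {n : ℕ} (hn : 2 ≤ n) (x : EuclideanSpace ℝ (Fin (n+1))) :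
    ∃ e : EuclideanSpace ℝ (Fin (n+1)), ‖e‖ = 1 ∧ e (Fin.last n) = 0 ∧
      s5L e (s5rho x, x (Fin.last n)) = x := by
  by_cases h : s5rho x = 0
  · refine ⟨EuclideanSpace.single 0 1, by simp, ?_, ?_⟩
    · have : Fin.last n ≠ 0 := by
        rw [ne_eq, Fin.ext_iff]; simp; omega
      simp [this]
    · rw [s5L_apply, h]
      have h2 : (WithLp.toLp 2 (fun i : Fin n => x i.castSucc) : EuclideanSpace ℝ (Fin n)) = 0 :=
        norm_eq_zero.mp h
      ext i
      refine Fin.lastCases ?_ (fun j => ?_) i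
      · simp
      · have := congrArg (fun y : EuclideanSpace ℝ (Fin n) => y j) h2
        simp at this
        simp [this, (Fin.castSucc_lt_last j).ne]
  · refine ⟨(s5rho x)⁻¹ • (x - x (Fin.last n) • EuclideanSpace.single (Fin.last n) (1:ℝ)), ?_, ?_, ?_⟩
    · have h0 := s5rho_nonneg x
      rw [norm_smul, norm_inv, Real.norm_of_nonneg h0]
      have : ‖x - x (Fin.last n) • EuclideanSpace.single (Fin.last n) (1:ℝ)‖ ^ 2 = s5rho x ^ 2 := by
        rw [norm_sub_sq_real, inner_smul_right, EuclideanSpace.inner_single_right, norm_smul, s5_norm_sq]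
        simp
        ring
      rw [pow_left_inj₀ (norm_nonneg _) h0 (by norm_num)] at this
      rw [this, inv_mul_cancel₀ h]
    · simp
    · rw [s5L_apply]
      simp only
      rw [smul_smul, mul_inv_cancel₀ h]
      simp

lemma s5_eta (a b R : ℝ) (hab : a < b) : ∃ η : ℝ → ℝ, ContDiff ℝ 1 η ∧ (∀ t, 0 ≤ η t) ∧ (∀ t, η t ≤ 1)
    ∧ (∀ t ≤ a, η t = 0) ∧ (∀ t, b ≤ t → η t = 1) ∧ ∃ M, ∀ t ∈ Icc a R, |deriv η t| ≤ M := by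
  have hc : ContDiff ℝ 1 (fun t : ℝ => Real.smoothTransition ((t - a) / (b - a))) :=
    Real.smoothTransition.contDiff.comp (by fun_prop)
  refine ⟨fun t => Real.smoothTransition ((t - a) / (b - a)), hc, fun t => Real.smoothTransition.nonneg _,
    fun t => Real.smoothTransition.le_one _, fun t ht => Real.smoothTransition.zero_of_nonpos ?_,
    fun t ht => Real.smoothTransition.one_of_one_le ?_, ?_⟩
  · exact div_nonpos_of_nonpos_of_nonneg (by linarith) (by linarith)
  · rw [le_div_iff₀ (by linarith)]; linarith
  · exact (isCompact_Icc (a := a) (b := R)).exists_bound_of_continuousOn (hc.continuous_deriv le_rfl).continuousOn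

lemma s5_C (n : ℕ) (hn : 2 ≤ n) (a b R : ℝ) (ha : 0 < a) (hab : a < b) (q : ℝ) (hq : 1 ≤ q) :
    ∃ C : ENNReal, C ≠ ⊤ ∧ ∀ f : EuclideanSpace ℝ (Fin (n+1)) → ℝ, ContDiff ℝ 1 f →
      (∀ x, f x ≠ 0 → ‖x‖ ≤ R) →
      (∀ x y, ‖x‖ = ‖y‖ → x (Fin.last n) = y (Fin.last n) → f x = f y) →
      (∫⁻ x in {x | b ≤ s5rho x}, ENNReal.ofReal (|f x| ^ q)) ^ (1 / q) ≤
        C * (∫⁻ x, ENNReal.ofReal (‖fderiv ℝ f x‖ ^ 2 + f x ^ 2)) ^ (1 / 2 : ℝ) := by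
  have hq0 : 0 < q := by linarith
  obtain ⟨η, hη, hη0, hη1, hηa, hηb, M, hM⟩ := s5_eta a b R hab
  obtain ⟨c, hc0, hct, hc⟩ := s5_push n hn
  let s : Set (ℝ × ℝ) := Icc a R ×ˢ Icc (-R) R
  obtain ⟨C₂, hC₂, hgns⟩ := s5_gns q hq s (isCompact_Icc.prod isCompact_Icc)
  set K : ℝ := 2 * (M ^ 2 + 1) with hK
  have hK0 : 0 < K := by positivity
  set K' : ENNReal := ENNReal.ofReal (K / a ^ (n-1)) with hK'
  refine ⟨(c * ENNReal.ofReal (R ^ (n-1))) ^ (1 / q) * (C₂ * (K' * (c⁻¹ * 4)) ^ (1 / 2 : ℝ)), ?_, ?_⟩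
  · refine ENNReal.mul_ne_top (ENNReal.rpow_ne_top_of_nonneg (by positivity)
      (ENNReal.mul_ne_top hct ENNReal.ofReal_ne_top)) (ENNReal.mul_ne_top hC₂
        (ENNReal.rpow_ne_top_of_nonneg (by positivity) ?_))
    refine ENNReal.mul_ne_top ENNReal.ofReal_ne_top (ENNReal.mul_ne_top (ENNReal.inv_ne_top.mpr hc0) (by norm_num))
  intro f hf hsupp hsym
  obtain ⟨e₀, he₀, he₀', -⟩ := s5_exists_e hn (0 : EuclideanSpace ℝ (Fin (n+1)))
  set w : ℝ × ℝ → ℝ := fun p => f (s5L e₀ p) with hw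
  have hwc : ContDiff ℝ 1 w := hf.comp (s5L e₀).contDiff
  have hwe : ∀ e : EuclideanSpace ℝ (Fin (n+1)), ‖e‖ = 1 → e (Fin.last n) = 0 → w = fun p => f (s5L e p) := by
    intro e he he'
    funext p
    refine hsym _ _ ?_ ?_
    · rw [← pow_left_inj₀ (norm_nonneg _) (norm_nonneg _) (two_ne_zero), s5L_norm_sq _ he₀ he₀',
        s5L_norm_sq _ he he']
    · rw [s5L_last _ he₀', s5L_last _ he']
  have hwx : ∀ x, w (s5rho x, x (Fin.last n)) = f x := by
    intro x
    obtain ⟨e, he, he', hx⟩ := s5_exists_e hn x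
    rw [hwe e he he']
    simp only [hx]
  have hwd : ∀ x, ‖fderiv ℝ w (s5rho x, x (Fin.last n))‖ ≤ 2 * ‖fderiv ℝ f x‖ := by
    intro x
    obtain ⟨e, he, he', hx⟩ := s5_exists_e hn x
    have hd : DifferentiableAt ℝ f (s5L e (s5rho x, x (Fin.last n))) :=
      (hf.differentiable (by norm_num)).differentiableAt
    have := (hd.hasFDerivAt.comp (s5rho x, x (Fin.last n)) (s5L e).hasFDerivAt).fderiv
    rw [hwe e he he']
    have h2 : fderiv ℝ (fun p => f (s5L e p)) (s5rho x, x (Fin.last n)) = _ := this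
    rw [h2, hx]
    refine (ContinuousLinearMap.opNorm_comp_le _ _).trans ?_
    rw [mul_comm]
    exact mul_le_mul_of_nonneg_right (s5L_norm e he) (norm_nonneg _)
  have hws : ∀ p, w p ≠ 0 → |p.1| ≤ R ∧ |p.2| ≤ R := by
    intro p hp
    have h1 := hsupp _ hp
    have h2 := s5L_norm_sq _ he₀ he₀' p
    have h0 : 0 ≤ R := (norm_nonneg _).trans h1
    have h3 : ‖s5L e₀ p‖ ^ 2 ≤ R ^ 2 := pow_le_pow_left₀ (norm_nonneg _) h1 2
    constructor <;> refine abs_le_of_sq_le_sq ?_ h0 <;> nlinarith [sq_nonneg p.1, sq_nonneg p.2]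
  set v : ℝ × ℝ → ℝ := fun p => η p.1 * w p with hv
  have hvc : ContDiff ℝ 1 v := (hη.comp contDiff_fst).mul hwc
  have hvs : Function.support v ⊆ s := by
    intro p hp
    have hp' : η p.1 * w p ≠ 0 := hp
    obtain ⟨h1, h2⟩ := hws p (right_ne_zero_of_mul hp')
    refine ⟨⟨?_, (abs_le.mp h1).2⟩, abs_le.mp h2⟩
    by_contra hcon
    exact left_ne_zero_of_mul hp' (hηa _ (not_le.mp hcon).le)
  have hfst : ‖ContinuousLinearMap.fst ℝ ℝ ℝ‖ ≤ 1 := ContinuousLinearMap.norm_fst_le ℝ ℝ ℝ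
  -- pointwise derivative bound
  have hvd : ∀ p : ℝ × ℝ, a ≤ p.1 → ‖fderiv ℝ v p‖ ^ 2 ≤ K * (‖fderiv ℝ w p‖ ^ 2 + w p ^ 2) := by
    intro p hp
    have hd1 : HasFDerivAt (fun p : ℝ × ℝ => η p.1) (deriv η p.1 • ContinuousLinearMap.fst ℝ ℝ ℝ) p :=
      HasDerivAt.comp_hasFDerivAt (h₂ := η) (f := Prod.fst) p ((hη.differentiable (by norm_num)) p.1).hasDerivAt
        hasFDerivAt_fst
    have hd2 := hd1.mul ((hwc.differentiable (by norm_num)) p).hasFDerivAt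
    have hd3 : fderiv ℝ v p = η p.1 • fderiv ℝ w p + w p • deriv η p.1 • ContinuousLinearMap.fst ℝ ℝ ℝ :=
      hd2.fderiv
    have h4 : ‖fderiv ℝ v p‖ ≤ ‖fderiv ℝ w p‖ + |w p| * |M| := by
      rw [hd3]
      refine (norm_add_le _ _).trans (add_le_add ?_ ?_)
      · rw [norm_smul, Real.norm_of_nonneg (hη0 _)]
        exact mul_le_of_le_one_left (norm_nonneg _) (hη1 _)
      · rw [norm_smul, Real.norm_eq_abs]
        by_cases hwp : w p = 0
        · simp [hwp]
        · have h5 := hM p.1 ⟨hp, (abs_le.mp (hws p hwp).1).2⟩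
          refine mul_le_mul_of_nonneg_left ?_ (abs_nonneg _)
          rw [norm_smul, Real.norm_eq_abs]
          calc |deriv η p.1| * _ ≤ |deriv η p.1| * 1 := by gcongr
            _ ≤ |M| := by rw [mul_one]; exact h5.trans (le_abs_self _)
    have h5 := pow_le_pow_left₀ (norm_nonneg _) h4 2
    refine h5.trans ?_
    rw [hK, ← sq_abs (w p), ← sq_abs M]
    nlinarith [sq_nonneg (‖fderiv ℝ w p‖ - |w p| * |M|), mul_nonneg (sq_nonneg ‖fderiv ℝ w p‖) (sq_nonneg |M|), sq_nonneg (|w p|)]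
  have hvd0 : ∀ p : ℝ × ℝ, p.1 < a → fderiv ℝ v p = 0 := by
    intro p hp
    have : v =ᶠ[nhds p] fun _ => 0 := by
      filter_upwards [(isOpen_lt continuous_fst continuous_const).mem_nhds hp] with y hy
      have hy' : y.1 < a := hy
      simp [hv, hηa _ hy'.le]
    rw [this.fderiv_eq]
    simp
  have hgrad : ∫⁻ p, ENNReal.ofReal (‖fderiv ℝ v p‖ ^ 2) ≤
      K' * (c⁻¹ * 4) * ∫⁻ x, ENNReal.ofReal (‖fderiv ℝ f x‖ ^ 2 + f x ^ 2) := by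
    set G : ℝ × ℝ → ENNReal := fun p => ENNReal.ofReal (‖fderiv ℝ w p‖ ^ 2 + w p ^ 2) with hG
    have hwdc := hwc.continuous_fderiv (by norm_num)
    have hwc' := hwc.continuous
    have hGm : Measurable G := by
      refine (ENNReal.continuous_ofReal.comp ?_).measurable
      fun_prop
    have hvdc := hvc.continuous_fderiv (by norm_num)
    calc ∫⁻ p, ENNReal.ofReal (‖fderiv ℝ v p‖ ^ 2)
        = ∫⁻ z : ℝ, ∫⁻ r : ℝ, ENNReal.ofReal (‖fderiv ℝ v (r, z)‖ ^ 2) := by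
          rw [Measure.volume_eq_prod, lintegral_prod_symm' _ (by
            refine (ENNReal.continuous_ofReal.comp ?_).measurable; fun_prop)]
      _ ≤ ∫⁻ z : ℝ, ∫⁻ r : ℝ in Ioi 0, K' * (ENNReal.ofReal (r ^ (n-1)) * G (r, z)) := by
          refine lintegral_mono fun z => ?_
          rw [← lintegral_indicator measurableSet_Ioi]
          refine lintegral_mono fun r => ?_
          simp only
          by_cases hr : r < a
          · rw [hvd0 (r, z) hr]; simp
          · push Not at hr
            rw [indicator_of_mem (show r ∈ Ioi (0:ℝ) from ha.trans_le hr), hK', hG,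
              ← ENNReal.ofReal_mul (pow_nonneg (ha.le.trans hr) _), ← ENNReal.ofReal_mul (by positivity)]
            refine ENNReal.ofReal_le_ofReal ((hvd (r, z) hr).trans ?_)
            have h1 : a ^ (n-1) ≤ r ^ (n-1) := pow_le_pow_left₀ ha.le hr _
            have h2 : K ≤ K / a ^ (n-1) * r ^ (n-1) := by
              rw [div_mul_eq_mul_div, le_div_iff₀ (by positivity)]
              gcongr
            rw [← mul_assoc]
            gcongr
      _ = K' * (c⁻¹ * (c * ∫⁻ z : ℝ, ∫⁻ r : ℝ in Ioi 0, (ENNReal.ofReal (r ^ (n-1)) * G (r, z)))) := by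
          rw [← mul_assoc c⁻¹, ENNReal.inv_mul_cancel hc0 hct, one_mul,
            ← lintegral_const_mul' _ _ ENNReal.ofReal_ne_top]
          congr 1 with z
          rw [← lintegral_const_mul' _ _ ENNReal.ofReal_ne_top]
      _ = K' * (c⁻¹ * ∫⁻ x : EuclideanSpace ℝ (Fin (n+1)), G (s5rho x, x (Fin.last n))) := by
          rw [hc G hGm]
      _ ≤ K' * (c⁻¹ * (4 * ∫⁻ x, ENNReal.ofReal (‖fderiv ℝ f x‖ ^ 2 + f x ^ 2))) := by
          gcongr
          rw [← lintegral_const_mul' _ _ (by norm_num)]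
          refine lintegral_mono fun x => ?_
          simp only [hG]
          rw [hwx, show (4 : ENNReal) = ENNReal.ofReal 4 by norm_num, ← ENNReal.ofReal_mul (by norm_num)]
          apply ENNReal.ofReal_le_ofReal
          have := pow_le_pow_left₀ (norm_nonneg _) (hwd x) 2
          nlinarith [sq_nonneg (f x)]
      _ = _ := by ring
  have hleft : ∫⁻ x in {x | b ≤ s5rho x}, ENNReal.ofReal (|f x| ^ q) ≤
      c * ENNReal.ofReal (R ^ (n-1)) * ∫⁻ p, ENNReal.ofReal (|v p| ^ q) := by
    have hvc' := hvc.continuous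
    have hm : Measurable fun p => ENNReal.ofReal (|v p| ^ q) := by
      apply Continuous.measurable
      refine ENNReal.continuous_ofReal.comp (Continuous.rpow_const (by fun_prop) fun _ => Or.inr hq0.le)
    calc ∫⁻ x in {x | b ≤ s5rho x}, ENNReal.ofReal (|f x| ^ q)
        ≤ ∫⁻ x : EuclideanSpace ℝ (Fin (n+1)), ENNReal.ofReal (|v (s5rho x, x (Fin.last n))| ^ q) := by
          rw [← lintegral_indicator (measurableSet_le measurable_const s5rho_continuous.measurable)]
          refine lintegral_mono fun x => ?_
          simp only [indicator_apply, mem_ofPred_eq]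
          split_ifs with hx
          · simp only [hv]
            rw [hwx, hηb _ hx, one_mul]
          · exact zero_le
      _ = c * ∫⁻ z : ℝ, ∫⁻ r in Ioi (0:ℝ), ENNReal.ofReal (r ^ (n-1)) * ENNReal.ofReal (|v (r, z)| ^ q) := by
          rw [hc (fun p => ENNReal.ofReal (|v p| ^ q)) hm]
      _ ≤ c * ∫⁻ z : ℝ, ∫⁻ r : ℝ, ENNReal.ofReal (R ^ (n-1)) * ENNReal.ofReal (|v (r, z)| ^ q) := by
          refine mul_le_mul_right (lintegral_mono fun z => ?_) c
          rw [← lintegral_indicator measurableSet_Ioi]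
          refine lintegral_mono fun r => ?_
          simp only [indicator_apply, mem_Ioi]
          split_ifs with hr
          · by_cases hvr : v (r, z) = 0
            · simp [hvr, hq0.ne']
            · have := (hvs hvr).1.2
              gcongr
          · exact zero_le
      _ = _ := by
          rw [mul_assoc, Measure.volume_eq_prod, lintegral_prod_symm' _ hm,
            ← lintegral_const_mul' _ _ ENNReal.ofReal_ne_top]
          congr 2 with z
          rw [← lintegral_const_mul' _ _ ENNReal.ofReal_ne_top]
  calc _ ≤ (c * ENNReal.ofReal (R ^ (n-1)) * ∫⁻ p, ENNReal.ofReal (|v p| ^ q)) ^ (1 / q) := by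
        gcongr
    _ = (c * ENNReal.ofReal (R ^ (n-1))) ^ (1 / q) * (∫⁻ p, ENNReal.ofReal (|v p| ^ q)) ^ (1 / q) :=
        ENNReal.mul_rpow_of_nonneg _ _ (by positivity)
    _ ≤ (c * ENNReal.ofReal (R ^ (n-1))) ^ (1 / q) * (C₂ * (K' * (c⁻¹ * 4) *
          ∫⁻ x, ENNReal.ofReal (‖fderiv ℝ f x‖ ^ 2 + f x ^ 2)) ^ (1 / 2 : ℝ)) := by
        gcongr
        refine (hgns v hvc hvs).trans ?_
        gcongr
    _ = _ := by
        rw [ENNReal.mul_rpow_of_nonneg _ _ (by positivity : (0:ℝ) ≤ 1 / 2)]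
        ring

lemma s5_D (n : ℕ) (hn : 2 ≤ n) (R₀ : ℝ) (hR₀ : 0 < R₀) (q : ℝ) (hq : 1 ≤ q)
    (f : EuclideanSpace ℝ (Fin (n+1)) → ℝ) (hf : Continuous f) (hf0 : ∀ x, 0 ≤ f x)
    (hsupp : ∀ x, f x ≠ 0 → R₀ ≤ ‖x‖)
    (hmono : ∀ x y, ‖x‖ = ‖y‖ → |y (Fin.last n)| ≤ |x (Fin.last n)| → f x ≤ f y) :
    ∫⁻ x, ENNReal.ofReal (|f x| ^ q) ≤
      2 * ∫⁻ x in {x | 2 * R₀ / 3 ≤ s5rho x}, ENNReal.ofReal (|f x| ^ q) := by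
  have hq0 : 0 < q := by linarith
  set S : Set (EuclideanSpace ℝ (Fin (n+1))) := {x | 2 * R₀ / 3 ≤ s5rho x} with hS
  have hSm : MeasurableSet S := measurableSet_le measurable_const s5rho_continuous.measurable
  let σ : EuclideanSpace ℝ (Fin (n+1)) ≃ₗᵢ[ℝ] EuclideanSpace ℝ (Fin (n+1)) :=
    LinearIsometryEquiv.piLpCongrLeft 2 ℝ ℝ (Equiv.swap 0 (Fin.last n))
  have hσ : ∀ x, σ x (Fin.last n) = x 0 := by
    intro x
    simp [σ, LinearIsometryEquiv.piLpCongrLeft_apply, Equiv.piCongrLeft']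
  rw [← lintegral_add_compl _ hSm, two_mul]
  refine add_le_add le_rfl ?_
  have hmp := σ.measurePreserving.lintegral_comp_emb σ.toHomeomorph.measurableEmbedding
    (S.indicator fun x => ENNReal.ofReal (|f x| ^ q))
  rw [← lintegral_indicator hSm, ← lintegral_indicator hSm.compl, ← hmp]
  refine lintegral_mono fun x => ?_
  by_cases hx : x ∈ S
  · rw [indicator_of_notMem (by simpa using hx)]
    exact zero_le
  rw [indicator_of_mem (by simpa using hx)]
  by_cases hfx : f x = 0
  · simp [hfx, hq0.ne']
  have h1 := hsupp x hfx
  have h2 : s5rho x < 2 * R₀ / 3 := not_le.mp hx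
  have h3 := s5_norm_sq x
  have h4 := s5rho_nonneg x
  have h5 : R₀ ^ 2 ≤ ‖x‖ ^ 2 := pow_le_pow_left₀ hR₀.le h1 2
  have h6 : s5rho x ^ 2 ≤ (2 * R₀ / 3) ^ 2 := pow_le_pow_left₀ h4 h2.le 2
  have h7 : x 0 ^ 2 ≤ s5rho x ^ 2 := by
    have : ‖(WithLp.toLp 2 (fun i : Fin n => x i.castSucc) : EuclideanSpace ℝ (Fin n)) ⟨0, by omega⟩‖ ≤ s5rho x :=
      PiLp.norm_apply_le _ _
    have h8 := pow_le_pow_left₀ (norm_nonneg _) this 2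
    rw [Real.norm_eq_abs, sq_abs] at h8
    exact h8
  have h9 := s5_norm_sq (σ x)
  rw [hσ, σ.norm_map] at h9
  have hmem : σ x ∈ S := by
    change 2 * R₀ / 3 ≤ s5rho (σ x)
    refine le_of_sq_le_sq ?_ (s5rho_nonneg _)
    nlinarith
  rw [indicator_of_mem hmem]
  apply ENNReal.ofReal_le_ofReal
  rw [abs_of_nonneg (hf0 _), abs_of_nonneg (hf0 _)]
  refine Real.rpow_le_rpow (hf0 _) ?_ hq0.le
  refine hmono x (σ x) (σ.norm_map x).symm ?_
  rw [hσ]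
  refine sq_le_sq.mp ?_
  nlinarith

lemma s5_phi (ε : ℝ) (hε : 0 < ε) : ∃ φ : ℝ → ℝ, ContDiff ℝ 1 φ ∧ Monotone φ ∧ (∀ t ≤ ε, φ t = 0) ∧
    (∀ t, 0 ≤ t → φ t ≤ t) ∧ (∀ t, 0 ≤ t → t - 2 * ε ≤ φ t) ∧ (∀ t, |deriv φ t| ≤ 1) := by
  set g : ℝ → ℝ := fun s => Real.smoothTransition (s / ε - 1) with hg
  have hgc : Continuous g := Real.smoothTransition.continuous.comp (by fun_prop)
  have hg0 : ∀ s, 0 ≤ g s := fun s => Real.smoothTransition.nonneg _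
  have hg1 : ∀ s, g s ≤ 1 := fun s => Real.smoothTransition.le_one _
  have hgi : ∀ a b, IntervalIntegrable g volume a b := fun a b => hgc.intervalIntegrable a b
  have hd : ∀ t, HasDerivAt (fun t => ∫ s in (0:ℝ)..t, g s) (g t) t := fun t => hgc.integral_hasStrictDerivAt 0 t |>.hasDerivAt
  have hd' : deriv (fun t => ∫ s in (0:ℝ)..t, g s) = g := funext fun t => (hd t).deriv
  have hm : Monotone (fun t => ∫ s in (0:ℝ)..t, g s) :=
    monotone_of_deriv_nonneg (fun t => (hd t).differentiableAt) (fun t => by rw [hd']; exact hg0 t)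
  have hz : ∀ s ≤ ε, g s = 0 := by
    intro s hs
    apply Real.smoothTransition.zero_of_nonpos
    have : s / ε ≤ 1 := by rw [div_le_one hε]; exact hs
    linarith
  refine ⟨fun t => ∫ s in (0:ℝ)..t, g s, ?_, hm, ?_, ?_, ?_, ?_⟩
  · rw [contDiff_one_iff_deriv, hd']
    exact ⟨fun t => (hd t).differentiableAt, hgc⟩
  · intro t ht
    have : EqOn g (fun _ => 0) (uIcc 0 t) := by
      intro s hs
      apply hz
      exact hs.2.trans (sup_le hε.le ht)
    simp only
    rw [intervalIntegral.integral_congr this]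
    simp
  · intro t ht
    have := intervalIntegral.integral_mono_on ht (hgi 0 t) (intervalIntegrable_const (c := (1:ℝ))) (fun s _ => hg1 s)
    simpa using this
  · intro t ht
    have h0 : 0 ≤ ∫ s in (0:ℝ)..t, g s := intervalIntegral.integral_nonneg ht fun s _ => hg0 s
    by_cases h : t ≤ 2 * ε
    · simp only; linarith
    · push Not at h
      have h1 : ∫ s in (2 * ε)..t, g s = t - 2 * ε := by
        have : EqOn g (fun _ => 1) (uIcc (2 * ε) t) := by
          intro s hs
          apply Real.smoothTransition.one_of_one_le
          rw [uIcc_of_le h.le] at hs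
          have : 2 ≤ s / ε := by rw [le_div_iff₀ hε]; exact hs.1
          linarith
        rw [intervalIntegral.integral_congr this]
        simp
      have h2 := intervalIntegral.integral_add_adjacent_intervals (hgi 0 (2*ε)) (hgi (2*ε) t)
      have h3 : 0 ≤ ∫ s in (0:ℝ)..(2*ε), g s := intervalIntegral.integral_nonneg (by positivity) fun s _ => hg0 s
      simp only
      linarith
  · intro t
    rw [hd', abs_of_nonneg (hg0 t)]
    exact hg1 t

lemma s5_annulus_open (N : ℕ) (R₀ R₁ : ℝ) : IsOpen (annulus N R₀ R₁) :=
  (isOpen_lt continuous_const continuous_norm).inter (isOpen_lt continuous_norm continuous_const)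

lemma s5_closure_sub (N : ℕ) (R₀ R₁ : ℝ) : ∀ x ∈ closure (annulus N R₀ R₁), R₀ ≤ ‖x‖ ∧ ‖x‖ ≤ R₁ := by
  have hc : IsClosed {x : EuclideanSpace ℝ (Fin N) | R₀ ≤ ‖x‖ ∧ ‖x‖ ≤ R₁} :=
    (isClosed_le continuous_const continuous_norm).inter (isClosed_le continuous_norm continuous_const)
  have hsub : annulus N R₀ R₁ ⊆ {x : EuclideanSpace ℝ (Fin N) | R₀ ≤ ‖x‖ ∧ ‖x‖ ≤ R₁} :=
    fun y hy => ⟨hy.1.le, hy.2.le⟩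
  exact fun x hx => closure_minimal hsub hc hx

lemma s5_compact (N : ℕ) (R₀ R₁ : ℝ) : IsCompact (closure (annulus N R₀ R₁)) := by
  refine Metric.isCompact_of_isClosed_isBounded isClosed_closure ?_
  refine (Metric.isBounded_closedBall (x := 0) (r := R₁)).subset fun x hx => ?_
  simpa using (s5_closure_sub N R₀ R₁ x hx).2

lemma s5_unique (N : ℕ) (R₀ R₁ : ℝ) (hR₀ : 0 < R₀) (hR : R₀ < R₁) :
    UniqueDiffOn ℝ (closure (annulus N R₀ R₁)) := by
  intro x hx
  obtain ⟨h1, h2⟩ := s5_closure_sub N R₀ R₁ x hx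
  have hx0 : 0 < ‖x‖ := hR₀.trans_le h1
  set d : ℝ := (R₁ - R₀) / 4 with hd
  have hd0 : 0 < d := by rw [hd]; linarith
  obtain ⟨t, ht, h3, h4⟩ : ∃ t : ℝ, |t| = d ∧ R₀ ≤ |‖x‖ + t| - d ∧ |‖x‖ + t| + d ≤ R₁ := by
    by_cases h : ‖x‖ ≤ (R₀ + R₁) / 2
    · refine ⟨d, abs_of_pos hd0, ?_, ?_⟩ <;> rw [abs_of_pos (by linarith)] <;> linarith
    · refine ⟨-d, by rw [abs_neg, abs_of_pos hd0], ?_, ?_⟩ <;> rw [abs_of_pos (by linarith)] <;> linarith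
  set c : EuclideanSpace ℝ (Fin N) := x + (t / ‖x‖) • x with hc
  have hcx : dist x c = d := by
    rw [hc, dist_eq_norm, sub_add_cancel_left, norm_neg, norm_smul, norm_div, norm_norm, Real.norm_eq_abs, ht]
    field_simp
  have hcn : ‖c‖ = |‖x‖ + t| := by
    have : c = (1 + t / ‖x‖) • x := by rw [hc, add_smul, one_smul]
    rw [this, norm_smul, Real.norm_eq_abs]
    nth_rewrite 2 [← abs_of_pos hx0]
    rw [← abs_mul]
    congr 1
    field_simp
  have hsub : Metric.ball c d ⊆ closure (annulus N R₀ R₁) := by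
    intro y hy
    apply subset_closure
    rw [Metric.mem_ball, dist_eq_norm] at hy
    have h5 := abs_norm_sub_norm_le y c
    have h6 := abs_lt.mp (h5.trans_lt hy)
    rw [hcn] at h6
    exact ⟨by linarith, by linarith⟩
  refine (uniqueDiffWithinAt_convex (convex_ball c d) ?_ ?_).mono hsub
  · rw [Metric.isOpen_ball.interior_eq]; exact ⟨c, Metric.mem_ball_self hd0⟩
  · rw [closure_ball _ hd0.ne', Metric.mem_closedBall, hcx]

lemma s5_mono (n : ℕ) (R₀ R₁ : ℝ) (u : EuclideanSpace ℝ (Fin (n+1)) → ℝ)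
    (hu : memKhat (n+1) R₀ R₁ u) : ∀ x y, x ∈ annulus (n+1) R₀ R₁ → ‖x‖ = ‖y‖ →
      |y (Fin.last n)| ≤ |x (Fin.last n)| → u x ≤ u y := by
  obtain ⟨-, -, U, hU, he, ha⟩ := hu
  intro x y hx hxy hl
  have hy : y ∈ annulus (n+1) R₀ R₁ := by
    have h1 := hx.1
    have h2 := hx.2
    rw [hxy] at h1 h2
    exact ⟨h1, h2⟩
  have key : ∀ z ∈ annulus (n+1) R₀ R₁, u z = U ‖z‖ (Real.arcsin (|z (Fin.last n)| / ‖z‖)) := by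
    intro z hz
    rw [hU z (subset_closure hz), angleOf]
    have hl : lastCoord z = z (Fin.last n) := by
      simp [lastCoord]; rfl
    rw [hl]
    rcases abs_cases (z (Fin.last n)) with ⟨h, -⟩ | ⟨h, -⟩
    · rw [h]
    · rw [h, neg_div, Real.arcsin_neg]
      exact (he _ ⟨hz.1.le, hz.2.le⟩ _ (Real.arcsin_mem_Icc _)).symm
  rw [key x hx, key y hy, ← hxy]
  have hm : ∀ t, 0 ≤ t → Real.arcsin t ∈ Icc 0 (π / 2) := fun t ht =>
    ⟨Real.arcsin_nonneg.mpr ht, Real.arcsin_le_pi_div_two t⟩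
  refine ha _ ⟨hx.1.le, hx.2.le⟩ (hm _ (by positivity)) (hm _ (by positivity)) ?_
  apply Real.monotone_arcsin
  gcongr

lemma s5_integrable (N : ℕ) (R₀ R₁ : ℝ) (hR₀ : 0 < R₀) (hR : R₀ < R₁)
    (u : EuclideanSpace ℝ (Fin N) → ℝ) (hu : ContDiffOn ℝ 1 u (closure (annulus N R₀ R₁))) :
    ENNReal.ofReal (H1sq N R₀ R₁ u) = ∫⁻ x in annulus N R₀ R₁, ENNReal.ofReal
      (‖fderivWithin ℝ u (closure (annulus N R₀ R₁)) x‖ ^ 2 + (u x) ^ 2) := by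
  have h1 := hu.continuousOn_fderivWithin (s5_unique N R₀ R₁ hR₀ hR) le_rfl
  have h2 : ContinuousOn (fun x => ‖fderivWithin ℝ u (closure (annulus N R₀ R₁)) x‖ ^ 2 + (u x) ^ 2)
      (closure (annulus N R₀ R₁)) := (h1.norm.pow 2).add (hu.continuousOn.pow 2)
  have h3 := (h2.integrableOn_compact (μ := volume) (s5_compact N R₀ R₁)).mono_set subset_closure
  exact ofReal_integral_eq_lintegral_ofReal h3 (Filter.Eventually.of_forall fun x => by positivity)

lemma s5_trunc (n : ℕ) (R₀ R₁ : ℝ) (u : EuclideanSpace ℝ (Fin (n+1)) → ℝ)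
    (hu : memK (n+1) R₀ R₁ u) (φ : ℝ → ℝ) (ε : ℝ) (hε : 0 < ε)
    (hφ : ContDiff ℝ 1 φ) (hφm : Monotone φ) (hφ0 : ∀ t ≤ ε, φ t = 0)
    (hφ1 : ∀ t, 0 ≤ t → φ t ≤ t) (hφd : ∀ t, |deriv φ t| ≤ 1) :
    ∃ f : EuclideanSpace ℝ (Fin (n+1)) → ℝ, ContDiff ℝ 1 f ∧ (∀ x, 0 ≤ f x) ∧
      (∀ x, f x ≠ 0 → x ∈ annulus (n+1) R₀ R₁) ∧
      (∀ x ∈ annulus (n+1) R₀ R₁, f x = φ (u x)) ∧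
      (∀ x y, ‖x‖ = ‖y‖ → |y (Fin.last n)| ≤ |x (Fin.last n)| → f x ≤ f y) ∧
      (∫⁻ x, ENNReal.ofReal (‖fderiv ℝ f x‖ ^ 2 + f x ^ 2) ≤
        ∫⁻ x in annulus (n+1) R₀ R₁, ENNReal.ofReal
      (‖fderivWithin ℝ u (closure (annulus (n+1) R₀ R₁)) x‖ ^ 2 + (u x) ^ 2)) := by
  classical
  set A := annulus (n+1) R₀ R₁ with hA
  have hAo : IsOpen A := s5_annulus_open _ _ _
  obtain ⟨hK, hb⟩ := hu
  have hmono := s5_mono n R₀ R₁ u hK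
  obtain ⟨hC, hnn, -⟩ := hK
  have hφnn : ∀ t, 0 ≤ t → 0 ≤ φ t := fun t ht => by
    rw [← hφ0 0 hε.le]; exact hφm ht
  set f : EuclideanSpace ℝ (Fin (n+1)) → ℝ := A.indicator fun x => φ (u x) with hf
  have hfA : ∀ x ∈ A, f x = φ (u x) := fun x hx => indicator_of_mem hx _
  have hfnA : ∀ x, x ∉ A → f x = 0 := fun x hx => indicator_of_notMem hx _
  set T : Set (EuclideanSpace ℝ (Fin (n+1))) := closure A ∩ u ⁻¹' Ici ε with hT
  have hTc : IsClosed T := hC.continuousOn.preimage_isClosed_of_isClosed isClosed_closure isClosed_Ici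
  have hTA : T ⊆ A := by
    rintro x ⟨hx, hx2⟩
    obtain ⟨h1, h2⟩ := s5_closure_sub _ _ _ x hx
    have hx3 : ε ≤ u x := hx2
    refine ⟨lt_of_le_of_ne h1 fun h => ?_, lt_of_le_of_ne h2 fun h => ?_⟩
    · have := hb x (Or.inl h.symm); linarith
    · have := hb x (Or.inr h); linarith
  have hfT : ∀ x ∉ T, f x = 0 := by
    intro x hx
    by_cases hxA : x ∈ A
    · rw [hfA x hxA]
      apply hφ0
      by_contra hcon
      exact hx ⟨subset_closure hxA, (not_le.mp hcon).le⟩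
    · exact hfnA x hxA
  have hnA : ∀ x, x ∉ A → f =ᶠ[nhds x] fun _ => 0 := by
    intro x hx
    filter_upwards [hTc.isOpen_compl.mem_nhds (fun h => hx (hTA h))] with y hy
    exact hfT y hy
  have hiA : ∀ x ∈ A, f =ᶠ[nhds x] fun y => φ (u y) := by
    intro x hx
    filter_upwards [hAo.mem_nhds hx] with y hy
    exact hfA y hy
  have hclo : ∀ x ∈ A, closure A ∈ nhds x := fun x hx =>
    Filter.mem_of_superset (hAo.mem_nhds hx) subset_closure
  have hCA : ∀ x ∈ A, ContDiffAt ℝ 1 u x := fun x hx => hC.contDiffAt (hclo x hx)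
  refine ⟨f, ?_, ?_, ?_, hfA, ?_, ?_⟩
  · rw [contDiff_iff_contDiffAt]
    intro x
    by_cases hx : x ∈ A
    · exact (hφ.contDiffAt.comp x (hCA x hx)).congr_of_eventuallyEq (hiA x hx)
    · exact contDiffAt_const.congr_of_eventuallyEq (hnA x hx)
  · intro x
    by_cases hx : x ∈ A
    · rw [hfA x hx]; exact hφnn _ (hnn x (subset_closure hx))
    · rw [hfnA x hx]
  · intro x hx
    by_contra hcon
    exact hx (hfnA x hcon)
  · intro x y hxy hl
    by_cases hx : x ∈ A
    · have hy : y ∈ A := by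
        have h1 := hx.1
        have h2 := hx.2
        rw [hxy] at h1 h2
        exact ⟨h1, h2⟩
      rw [hfA x hx, hfA y hy]
      exact hφm (hmono x y hx hxy hl)
    · have hy : y ∉ A := by
        intro hy
        have h1 := hy.1
        have h2 := hy.2
        rw [← hxy] at h1 h2
        exact hx ⟨h1, h2⟩
      rw [hfnA x hx, hfnA y hy]
  · rw [← lintegral_indicator hAo.measurableSet]
    refine lintegral_mono fun x => ?_
    by_cases hx : x ∈ A
    · simp only [indicator_of_mem hx]
      apply ENNReal.ofReal_le_ofReal
      have hux := hnn x (subset_closure hx)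
      have h1 : f x ^ 2 ≤ u x ^ 2 := by
        rw [hfA x hx]
        exact pow_le_pow_left₀ (hφnn _ hux) (hφ1 _ hux) 2
      have h2 : ‖fderiv ℝ f x‖ ≤ ‖fderivWithin ℝ u (closure A) x‖ := by
        rw [fderivWithin_of_mem_nhds (hclo x hx), (hiA x hx).fderiv_eq]
        have hdu := ((hCA x hx).differentiableAt (by norm_num)).hasFDerivAt
        have hdφ := ((hφ.differentiable (by norm_num)) (u x)).hasDerivAt
        have := hdφ.comp_hasFDerivAt x hdu
        have h3 : fderiv ℝ (fun y => φ (u y)) x = deriv φ (u x) • fderiv ℝ u x := this.fderiv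
        rw [h3, norm_smul, Real.norm_eq_abs]
        exact mul_le_of_le_one_left (norm_nonneg _) (hφd _)
      have := pow_le_pow_left₀ (norm_nonneg _) h2 2
      linarith
    · simp only [indicator_of_notMem hx]
      rw [(hnA x hx).fderiv_eq, hfnA x hx]
      simp

/-- a priori `L^q` bounds in the cone `K`. -/
theorem statement5 (N : ℕ) (hN : 3 ≤ N) (R₀ R₁ : ℝ) (hR₀ : 0 < R₀) (hR : R₀ < R₁) :
    ∀ q : ℝ, 1 ≤ q → ∃ C : ℝ, 0 < C ∧
      ∀ u : EuclideanSpace ℝ (Fin N) → ℝ, memK N R₀ R₁ u →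
        (∫ x in annulus N R₀ R₁, |u x| ^ q) ^ (1 / q)
          ≤ C * Real.sqrt (H1sq N R₀ R₁ u) := by
  intro q hq
  have hq0 : 0 < q := by linarith
  obtain ⟨n, rfl⟩ : ∃ n, N = n + 1 := ⟨N - 1, by omega⟩
  have hn : 2 ≤ n := by omega
  obtain ⟨C, hC, hmain⟩ := s5_C n hn (R₀ / 2) (2 * R₀ / 3) R₁ (by linarith) (by linarith) q hq
  set C' : ENNReal := 2 ^ (1 / q) * C with hC'
  have hC't : C' ≠ ⊤ := ENNReal.mul_ne_top (ENNReal.rpow_ne_top_of_nonneg (by positivity) (by norm_num)) hC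
  refine ⟨C'.toReal + 1, by positivity, fun u hu => ?_⟩
  have hcd := hu.1.1
  have hnn := hu.1.2.1
  have hH0 : 0 ≤ H1sq (n+1) R₀ R₁ u := integral_nonneg fun x => by positivity
  have hH := s5_integrable (n+1) R₀ R₁ hR₀ hR u hcd
  set H : ENNReal := ENNReal.ofReal (H1sq (n+1) R₀ R₁ u) with hHdef
  have hAm : MeasurableSet (annulus (n+1) R₀ R₁) := (s5_annulus_open _ _ _).measurableSet
  choose φ h1 h2 h3 h4 h5 h6 using s5_phi
  let ε : ℕ → ℝ := fun k => 1 / ((k : ℝ) + 1)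
  have hε : ∀ k, 0 < ε k := fun k => by positivity
  choose f hf1 hf2 hf3 hf4 hf5 hf6 using fun k : ℕ => s5_trunc n R₀ R₁ u hu (φ (ε k) (hε k)) (ε k) (hε k)
    (h1 _ _) (h2 _ _) (h3 _ _) (h4 _ _) (h6 _ _)
  have hbound : ∀ k, ∫⁻ x, ENNReal.ofReal (|f k x| ^ q) ≤ (C' * H ^ (1 / 2 : ℝ)) ^ q := by
    intro k
    have hD := s5_D n hn R₀ hR₀ q hq (f k) (hf1 k).continuous (hf2 k)
      (fun x hx => (hf3 k x hx).1.le) (hf5 k)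
    have hM := hmain (f k) (hf1 k) (fun x hx => (hf3 k x hx).2.le)
      (fun x y hxy hl => le_antisymm (hf5 k x y hxy (by rw [hl])) (hf5 k y x hxy.symm (by rw [hl])))
    rw [← ENNReal.rpow_inv_le_iff hq0, ← one_div]
    calc _ ≤ (2 * ∫⁻ x in {x | 2 * R₀ / 3 ≤ s5rho x}, ENNReal.ofReal (|f k x| ^ q)) ^ (1 / q) := by
          exact ENNReal.rpow_le_rpow hD (by positivity)
      _ = 2 ^ (1 / q) * (∫⁻ x in {x | 2 * R₀ / 3 ≤ s5rho x}, ENNReal.ofReal (|f k x| ^ q)) ^ (1 / q) :=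
          ENNReal.mul_rpow_of_nonneg _ _ (by positivity)
      _ ≤ 2 ^ (1 / q) * (C * H ^ (1 / 2 : ℝ)) := by
          refine mul_le_mul_right (hM.trans ?_) _
          rw [hH]
          exact mul_le_mul_right (ENNReal.rpow_le_rpow (hf6 k) (by norm_num)) _
      _ = _ := by rw [hC', mul_assoc]
  have hlim : ∀ x ∈ annulus (n+1) R₀ R₁, Filter.Tendsto (fun k => ENNReal.ofReal (|f k x| ^ q)) Filter.atTop
      (nhds (ENNReal.ofReal (|u x| ^ q))) := by
    intro x hx
    have hux := hnn x (subset_closure hx)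
    have ht : Filter.Tendsto (fun k => f k x) Filter.atTop (nhds (u x)) := by
      have hε0 : Filter.Tendsto ε Filter.atTop (nhds 0) := tendsto_one_div_add_atTop_nhds_zero_nat
      refine tendsto_of_tendsto_of_tendsto_of_le_of_le (g := fun k => u x - 2 * ε k) (h := fun _ => u x) ?_
        tendsto_const_nhds ?_ ?_
      · simpa using (tendsto_const_nhds (x := u x)).sub (hε0.const_mul 2)
      · intro k
        simp only
        rw [hf4 k x hx]
        exact h5 _ _ _ hux
      · intro k
        simp only
        rw [hf4 k x hx]
        exact h4 _ _ _ hux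
    exact (ENNReal.continuous_ofReal.tendsto _).comp (ht.abs.rpow_const (Or.inr hq0.le))
  have hfatou : ∫⁻ x in annulus (n+1) R₀ R₁, ENNReal.ofReal (|u x| ^ q) ≤ (C' * H ^ (1 / 2 : ℝ)) ^ q := by
    calc ∫⁻ x in annulus (n+1) R₀ R₁, ENNReal.ofReal (|u x| ^ q)
        = ∫⁻ x in annulus (n+1) R₀ R₁, Filter.liminf (fun k => ENNReal.ofReal (|f k x| ^ q)) Filter.atTop := by
          refine setLIntegral_congr_fun hAm fun x hx => ?_
          exact (hlim x hx).liminf_eq.symm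
      _ ≤ Filter.liminf (fun k => ∫⁻ x in annulus (n+1) R₀ R₁, ENNReal.ofReal (|f k x| ^ q)) Filter.atTop := by
          refine lintegral_liminf_le fun k => ?_
          have := (hf1 k).continuous
          refine (ENNReal.continuous_ofReal.comp
            (Continuous.rpow_const (by fun_prop) fun _ => Or.inr hq0.le)).measurable
      _ ≤ _ := by
          refine Filter.liminf_le_of_frequently_le' (Filter.Frequently.of_forall fun k => ?_)
          exact (setLIntegral_le_lintegral _ _).trans (hbound k)
  have hIntegral : ∫ x in annulus (n+1) R₀ R₁, |u x| ^ q =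
      (∫⁻ x in annulus (n+1) R₀ R₁, ENNReal.ofReal (|u x| ^ q)).toReal := by
    refine integral_eq_lintegral_of_nonneg_ae (Filter.Eventually.of_forall fun x => by positivity) ?_
    have hc : ContinuousOn (fun x => |u x| ^ q) (annulus (n+1) R₀ R₁) :=
      ((hcd.continuousOn.mono subset_closure).abs).rpow_const fun _ _ => Or.inr hq0.le
    exact hc.aestronglyMeasurable hAm
  have hfin : C' * H ^ (1 / 2 : ℝ) ≠ ⊤ :=
    ENNReal.mul_ne_top hC't (ENNReal.rpow_ne_top_of_nonneg (by norm_num) ENNReal.ofReal_ne_top)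
  rw [hIntegral, ENNReal.toReal_rpow]
  rw [← ENNReal.rpow_inv_le_iff hq0, ← one_div] at hfatou
  refine (ENNReal.toReal_mono hfin hfatou).trans ?_
  rw [ENNReal.toReal_mul, ← ENNReal.toReal_rpow, hHdef, ENNReal.toReal_ofReal hH0, ← Real.sqrt_eq_rpow]
  have := Real.sqrt_nonneg (H1sq (n+1) R₀ R₁ u)
  linarith
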